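/- Let C₁ ⊆ A₁ and C₂ ⊆ A₂ be masas of unital C*-algebras, both with the extension property. If χ₁ and χ₂ are characters of C₁ and C₂ with unique (pure) state extensions ψ₁ to A₁ and ψ₂ to A₂, then for any abelian C*-subalgebra C of A₁ ⊗_β A₂ containing C₁ ⊗ C₂, every character of C extending χ₁ ⊗ χ₂ equals the restriction of ψ₁ ⊗ ψ₂ to C; consequently C = C₁ ⊗ C₂, so C₁ ⊗ C₂ is maximal abelian. -/

import Mathlib

set_option maxHeartbeats 1000000
set_option synthInstance.maxHeartbeats 1000000

open scoped ComplexOrder TensorProduct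

noncomputable section

/-- A state on a (possibly non-unital) normed star algebra: a norm-one positive
continuous linear functional. -/
def IsState {A : Type*} [NonUnitalNormedRing A] [StarRing A] [NormedSpace ℂ A]
    (φ : A →L[ℂ] ℂ) : Prop :=
  ‖φ‖ = 1 ∧ ∀ a : A, 0 ≤ φ (star a * a)

/-- A pure state: a state which is an extreme point of the state space. -/
def IsPureState {A : Type*} [NonUnitalNormedRing A] [StarRing A] [NormedSpace ℂ A]
    (φ : A →L[ℂ] ℂ) : Prop :=
  IsState φ ∧ ∀ (ψ₁ ψ₂ : A →L[ℂ] ℂ) (t : ℝ), IsState ψ₁ → IsState ψ₂ → 0 < t → t < 1 →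
    φ = (t : ℂ) • ψ₁ + ((1 : ℂ) - (t : ℂ)) • ψ₂ → ψ₁ = φ ∧ ψ₂ = φ

/-- A maximal abelian self-adjoint subalgebra (masa) of a (possibly non-unital)
C*-algebra: an abelian *-subalgebra equal to its own relative commutant. -/
def IsMasa {A : Type*} [NonUnitalCStarAlgebra A] (C : NonUnitalStarSubalgebra ℂ A) : Prop :=
  (∀ x ∈ C, ∀ y ∈ C, x * y = y * x) ∧ ∀ x : A, (∀ c ∈ C, c * x = x * c) → x ∈ C

/-- A masa of a unital C*-algebra (unital version). -/
def IsMasaU {A : Type*} [CStarAlgebra A] (C : StarSubalgebra ℂ A) : Prop :=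
  (∀ x ∈ C, ∀ y ∈ C, x * y = y * x) ∧ ∀ x : A, (∀ c ∈ C, c * x = x * c) → x ∈ C

/-- The Kadison-Singer extension property for a subalgebra of a possibly non-unital
C*-algebra: (i) every pure state (character) of `C` has a unique pure state extension
to `A`, and (ii) no pure state of `A` annihilates `C`. -/
def HasExtensionProperty {A : Type*} [NonUnitalCStarAlgebra A]
    (C : NonUnitalStarSubalgebra ℂ A) : Prop :=
  (∀ χ : ↥C →L[ℂ] ℂ, IsPureState χ →
      ∃! φ : A →L[ℂ] ℂ, IsPureState φ ∧ ∀ c : ↥C, φ ↑c = χ c) ∧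
  ∀ φ : A →L[ℂ] ℂ, IsPureState φ → ∃ c ∈ C, φ c ≠ 0

/-- The extension property for a unital subalgebra of a unital C*-algebra: every pure
state (character) of `C` has a unique pure state extension to `A`. -/
def HasExtensionPropertyU {A : Type*} [CStarAlgebra A] (C : StarSubalgebra ℂ A) : Prop :=
  ∀ χ : ↥C →L[ℂ] ℂ, IsPureState χ →
    ∃! φ : A →L[ℂ] ℂ, IsPureState φ ∧ ∀ c : ↥C, φ ↑c = χ c

/-- A C*-completion `T` of the algebraic tensor product `A₁ ⊙ A₂` with respect to a
C*-norm `β`: a C*-algebra together with commuting isometric embeddings of the factors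
such that the induced map on the algebraic tensor product is injective (i.e. the norm
of `T` restricts to a genuine C*-norm on `A₁ ⊙ A₂`) and has dense range. -/
structure CStarCompletion (A₁ A₂ T : Type*) [NonUnitalCStarAlgebra A₁]
    [NonUnitalCStarAlgebra A₂] [NonUnitalCStarAlgebra T] where
  ι₁ : A₁ →⋆ₙₐ[ℂ] T
  ι₂ : A₂ →⋆ₙₐ[ℂ] T
  isometry₁ : Isometry ι₁
  isometry₂ : Isometry ι₂
  commutes : ∀ (a : A₁) (b : A₂), ι₁ a * ι₂ b = ι₂ b * ι₁ a
  injective : ∀ (n : ℕ) (a : Fin n → A₁) (b : Fin n → A₂),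
      (∑ i, ι₁ (a i) * ι₂ (b i)) = 0 → (∑ i, a i ⊗ₜ[ℂ] b i : A₁ ⊗[ℂ] A₂) = 0
  dense_span : Dense (Submodule.span ℂ {x : T | ∃ a b, x = ι₁ a * ι₂ b} : Set T)

/-- The closure, in a C*-completion `T` of `A₁ ⊙ A₂`, of the linear span of the
elementary tensors `c₁ ⊗ c₂` with `cᵢ` in given subsets of the factors: this is the
canonical copy of `C₁ ⊗ C₂` inside `A₁ ⊗_β A₂`. -/
def tensorSet {A₁ A₂ T : Type*} [NonUnitalCStarAlgebra A₁] [NonUnitalCStarAlgebra A₂]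
    [NonUnitalCStarAlgebra T] (K : CStarCompletion A₁ A₂ T)
    (S₁ : Set A₁) (S₂ : Set A₂) : Set T :=
  closure (Submodule.span ℂ {x : T | ∃ a ∈ S₁, ∃ b ∈ S₂, x = K.ι₁ a * K.ι₂ b} : Set T)

/-- The canonical copy of `C₁ ⊗ C₂` inside `A₁ ⊗_β A₂`, as a closed non-unital
star subalgebra. -/
def tensorSubalg {A₁ A₂ T : Type*} [NonUnitalCStarAlgebra A₁] [NonUnitalCStarAlgebra A₂]
    [NonUnitalCStarAlgebra T] (K : CStarCompletion A₁ A₂ T)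
    (C₁ : NonUnitalStarSubalgebra ℂ A₁) (C₂ : NonUnitalStarSubalgebra ℂ A₂) :
    NonUnitalStarSubalgebra ℂ T :=
  (NonUnitalStarAlgebra.adjoin ℂ
    {x : T | ∃ a ∈ C₁, ∃ b ∈ C₂, x = K.ι₁ a * K.ι₂ b}).topologicalClosure

/-- A (two-sided) bounded approximate identity indexed by a directed set. -/
def IsApproxIdentity {A : Type*} [NonUnitalCStarAlgebra A] {ι : Type}
    [Preorder ι] (e : ι → A) : Prop :=
  (∀ i, ‖e i‖ ≤ 1) ∧ ∀ a : A,
    Filter.Tendsto (fun i => e i * a) Filter.atTop (nhds a) ∧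
    Filter.Tendsto (fun i => a * e i) Filter.atTop (nhds a)

/-- `S` contains a bounded approximate identity for `A`. -/
def ContainsApproxIdentity {A : Type*} [NonUnitalCStarAlgebra A] (S : Set A) : Prop :=
  ∃ (ι : Type) (_ : SemilatticeSup ι) (_ : Nonempty ι) (e : ι → A),
    (∀ i, e i ∈ S) ∧ IsApproxIdentity e

section PositiveFunctionals

variable {B : Type*} [Ring B] [StarRing B] [Algebra ℂ B] [StarModule ℂ B]

theorem map_star_of_nonneg (f : B →ₗ[ℂ] ℂ) (hf : ∀ a, 0 ≤ f (star a * a)) (x : B) :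
    f (star x) = starRingEnd ℂ (f x) := by
  have h0 := (Complex.le_def.1 (hf x)).2
  have h1 := (Complex.le_def.1 (hf 1)).2
  have h2 := (Complex.le_def.1 (hf (x + 1))).2
  have h3 := (Complex.le_def.1 (hf (x + Complex.I • 1))).2
  simp [add_mul, mul_add] at h0 h1 h2 h3
  apply Complex.ext <;> simp <;> linarith

theorem norm_sq_le_of_nonneg (f : B →ₗ[ℂ] ℂ) (hf : ∀ a, 0 ≤ f (star a * a)) (x : B) :
    ‖f x‖ ^ 2 ≤ (f 1).re * (f (star x * x)).re := by
  by_cases hz : f x = 0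
  · have h1 := (Complex.le_def.1 (hf 1)).1
    have h2 := (Complex.le_def.1 (hf x)).1
    simp at h1 h2
    simpa [hz] using mul_nonneg h1 h2
  have key : ∀ t : ℝ, 0 ≤ (‖f x‖ ^ 2 * (f 1).re) * (t * t) + (2 * ‖f x‖ ^ 2) * t
      + (f (star x * x)).re := by
    intro t
    have h1 := (Complex.le_def.1 (hf 1)).2
    have h := (Complex.le_def.1 (hf (x + ((t : ℂ) * f x) • 1))).1
    simp [add_mul, mul_add, map_star_of_nonneg f hf] at h h1
    rw [← Complex.normSq_eq_norm_sq, Complex.normSq_apply]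
    rw [← h1] at h
    linarith
  have h := discrim_le_zero key
  have hp : 0 < ‖f x‖ ^ 2 := by positivity
  rw [discrim] at h
  have : ‖f x‖ ^ 2 * (‖f x‖ ^ 2 - (f 1).re * (f (star x * x)).re) ≤ 0 := by nlinarith
  by_contra hc
  push Not at hc
  nlinarith [mul_pos hp (sub_pos.2 hc)]

theorem eq_of_multiplicative_of_convex (f g χ : B →ₗ[ℂ] ℂ) (hf : ∀ a, 0 ≤ f (star a * a))
    (hg : ∀ a, 0 ≤ g (star a * a)) (hχm : ∀ a b, χ (a * b) = χ a * χ b)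
    (hχ1 : χ 1 = 1) (hf1 : f 1 = 1)
    (t : ℝ) (ht0 : 0 < t) (ht1 : t < 1)
    (h : ∀ a, χ a = (t : ℂ) * f a + (1 - (t : ℂ)) * g a) (a : B) : f a = χ a := by
  set x := a - χ a • 1 with hx
  have hχx : χ x = 0 := by simp [hx, hχ1]
  have h0 : χ (star x * x) = 0 := by rw [hχm, hχx, mul_zero]
  have hfx := Complex.le_def.1 (hf x)
  have hgx := Complex.le_def.1 (hg x)
  rw [h] at h0
  have h0 := congrArg Complex.re h0
  simp at h0 hfx hgx
  have hz : (f (star x * x)).re = 0 := by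
    have h1 := mul_nonneg ht0.le hfx.1
    have h2 := mul_nonneg (sub_pos.2 ht1).le hgx.1
    have : t * (f (star x * x)).re = 0 := by linarith
    exact (mul_eq_zero.1 this).resolve_left ht0.ne'
  have hcs := norm_sq_le_of_nonneg f hf x
  rw [hz, mul_zero] at hcs
  have : f x = 0 := by
    have : ‖f x‖ ^ 2 = 0 := le_antisymm hcs (by positivity)
    simpa using this
  simpa [hx, hf1, sub_eq_zero] using this

end PositiveFunctionals

section States

variable {B : Type*} [NormedRing B] [StarRing B] [CStarRing B] [NormedAlgebra ℂ B] [StarModule ℂ B]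

theorem norm_sq_le_opNorm (f : B →L[ℂ] ℂ) (hf : ∀ a, 0 ≤ f (star a * a)) (x : B) :
    ‖f x‖ ^ 2 ≤ (f 1).re * (‖f‖ * ‖x‖ ^ 2) := by
  have h1 := (Complex.le_def.1 (hf 1)).1
  simp at h1
  refine (norm_sq_le_of_nonneg (f : B →ₗ[ℂ] ℂ) hf x).trans ?_
  refine mul_le_mul_of_nonneg_left ?_ h1
  refine (Complex.re_le_norm _).trans ((f.le_opNorm _).trans ?_)
  rw [CStarRing.norm_star_mul_self, sq]

theorem IsState.map_one {f : B →L[ℂ] ℂ} (hf : IsState f) : f 1 = 1 := by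
  have hnt : Nontrivial B := by
    by_contra hc
    rw [not_nontrivial_iff_subsingleton] at hc
    have : f = 0 := by ext x; simp [Subsingleton.elim x 0]
    simpa [this] using hf.1
  have h1 := Complex.le_def.1 (hf.2 1)
  simp at h1
  have hle : (f 1).re ≤ 1 := by
    refine (Complex.re_le_norm _).trans ((f.le_opNorm _).trans ?_)
    simp [hf.1]
  have hge : 1 ≤ Real.sqrt (f 1).re := by
    rw [← hf.1]
    refine f.opNorm_le_bound (Real.sqrt_nonneg _) fun x => ?_
    have := norm_sq_le_opNorm f hf.2 x
    rw [hf.1, one_mul] at this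
    rw [← Real.sqrt_sq (norm_nonneg x), ← Real.sqrt_mul h1.1]
    exact Real.le_sqrt_of_sq_le this
  have : 1 ≤ (f 1).re := by simpa using hge
  exact Complex.ext (by simp; linarith) (by simp [← h1.2])

theorem isState_of_nonneg_of_map_one {f : B →L[ℂ] ℂ} (hf : ∀ a, 0 ≤ f (star a * a))
    (h1 : f 1 = 1) : IsState f := by
  have hnt : Nontrivial B := by
    by_contra hc
    rw [not_nontrivial_iff_subsingleton] at hc
    simp [Subsingleton.elim (1 : B) 0] at h1
  refine ⟨le_antisymm ?_ ?_, hf⟩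
  · have : ‖f‖ ≤ Real.sqrt ‖f‖ := by
      refine f.opNorm_le_bound (Real.sqrt_nonneg _) fun x => ?_
      have := norm_sq_le_opNorm f hf x
      rw [h1, Complex.one_re, one_mul] at this
      rw [← Real.sqrt_sq (norm_nonneg x), ← Real.sqrt_mul (norm_nonneg _)]
      exact Real.le_sqrt_of_sq_le this
    by_contra hc
    push Not at hc
    have h2 := (Real.le_sqrt' (norm_pos_iff.2 fun h => by simp [h] at h1)).1 this
    nlinarith
  · have := f.le_opNorm 1
    simpa [h1] using this

theorem IsState.isPureState_of_multiplicative {f : B →L[ℂ] ℂ} (hf : IsState f)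
    (hm : ∀ a b, f (a * b) = f a * f b) : IsPureState f := by
  refine ⟨hf, fun g h t hg hh ht0 ht1 hfgh => ⟨?_, ?_⟩⟩
  · ext a
    exact eq_of_multiplicative_of_convex (g : B →ₗ[ℂ] ℂ) h f hg.2 hh.2 hm hf.map_one
      hg.map_one t ht0 ht1 (fun x => by simp [hfgh]) a
  · ext a
    exact eq_of_multiplicative_of_convex (h : B →ₗ[ℂ] ℂ) g f hh.2 hg.2 hm hf.map_one
      hh.map_one (1 - t) (by linarith) (by linarith) (fun x => by simp [hfgh]; ring) a

end States

section CStar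

variable {A : Type*} [CStarAlgebra A]

theorem exists_star_mul_self_eq_half_add {b : A} (hb : IsSelfAdjoint b) (hn : ‖b‖ ≤ 1 / 2) :
    ∃ c, (1 / 2 : ℝ) • 1 + b = star c * c := by
  let _ := CStarAlgebra.spectralOrder A
  have := CStarAlgebra.spectralOrderedRing A
  rw [← CStarAlgebra.nonneg_iff_eq_star_mul_self]
  have h := hb.neg_algebraMap_norm_le_self
  have h2 : algebraMap ℝ A ‖b‖ ≤ algebraMap ℝ A (1 / 2) := algebraMap_mono A hn
  rw [← Algebra.algebraMap_eq_smul_one, ← neg_le_iff_add_nonneg']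
  exact (neg_le_neg h2).trans h

/-- A functional of norm at most one taking the value one at the unit is a state. -/
theorem isState_of_norm_le_one {f : A →L[ℂ] ℂ} (hn : ‖f‖ ≤ 1) (h1 : f 1 = 1) : IsState f := by
  have hnt : Nontrivial A := by
    by_contra hc
    rw [not_nontrivial_iff_subsingleton] at hc
    simp [Subsingleton.elim (1 : A) 0] at h1
  have hsa : ∀ a : A, IsSelfAdjoint a → (f a).im = 0 := by
    intro a ha
    have key : ∀ t : ℝ, ((f a).im + t) ^ 2 ≤ ‖a‖ ^ 2 + t ^ 2 := by
      intro t
      set x := a + (t * Complex.I : ℂ) • (1 : A) with hx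
      have hxx : star x * x = a * a + ((t : ℂ) ^ 2) • (1 : A) := by
        simp [hx, ha.star_eq, add_mul, mul_add, smul_smul]
        rw [show (t * Complex.I * (t * Complex.I) : ℂ) = - (t : ℂ) ^ 2 by
          ring_nf; simp]
        module
      have h2 : ‖x‖ ^ 2 ≤ ‖a‖ ^ 2 + t ^ 2 := by
        rw [sq, ← CStarRing.norm_star_mul_self, hxx]
        refine (norm_add_le _ _).trans ?_
        refine add_le_add ((norm_mul_le _ _).trans_eq (sq _).symm) ?_
        simp [norm_smul]
      have h3 : ‖f x‖ ≤ ‖x‖ := (f.le_opNorm x).trans (by nlinarith [norm_nonneg x])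
      have h4 : |(f x).im| ≤ ‖x‖ := (Complex.abs_im_le_norm _).trans h3
      have h5 : (f x).im = (f a).im + t := by simp [hx, h1]
      rw [h5] at h4
      have := sq_le_sq' (abs_le.1 h4).1 (abs_le.1 h4).2
      linarith
    by_contra hne
    have := key ((‖a‖ ^ 2 + 1) / (2 * (f a).im))
    have h6 : 2 * (f a).im * ((‖a‖ ^ 2 + 1) / (2 * (f a).im)) = ‖a‖ ^ 2 + 1 := by field_simp
    nlinarith [sq_nonneg (f a).im]
  have hpos : ∀ a : A, ‖a‖ ≤ 1 → 0 ≤ (f (star a * a)).re := by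
    intro a ha
    let _ := CStarAlgebra.spectralOrder A
    have := CStarAlgebra.spectralOrderedRing A
    have hp : 0 ≤ star a * a := star_mul_self_nonneg a
    have hle : star a * a ≤ 1 := by
      rw [← CStarAlgebra.norm_le_one_iff_of_nonneg _ hp, CStarRing.norm_star_mul_self]
      nlinarith [norm_nonneg a]
    have h2 : ‖1 - star a * a‖ ≤ 1 := by
      rw [CStarAlgebra.norm_le_one_iff_of_nonneg _ (sub_nonneg.2 hle)]
      simp [hp]
    have h3 : ‖f (1 - star a * a)‖ ≤ 1 :=
      (f.le_opNorm _).trans (by nlinarith [norm_nonneg (1 - star a * a)])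
    have h4 := (Complex.re_le_norm _).trans h3
    simp [h1] at h4
    exact h4
  refine isState_of_nonneg_of_map_one (fun a => ?_) h1
  refine Complex.le_def.2 ⟨?_, ?_⟩
  · have hk : (0 : ℝ) < ‖a‖ + 1 := by positivity
    have h := hpos (((‖a‖ + 1 : ℝ) : ℂ)⁻¹ • a) (by
      rw [norm_smul, norm_inv, Complex.norm_real, Real.norm_of_nonneg hk.le, inv_mul_le_one₀ hk]
      linarith)
    rw [star_smul, smul_mul_smul_comm, map_smul, ← Complex.ofReal_inv, Complex.star_def,
      Complex.conj_ofReal, ← Complex.ofReal_mul, smul_eq_mul, Complex.re_ofReal_mul] at h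
    exact nonneg_of_mul_nonneg_right h (by positivity)
  · simpa using (hsa _ (IsSelfAdjoint.star_mul_self a)).symm

end CStar

section UniqueExtension

variable {A : Type*} [CStarAlgebra A]

/-- The states extending `ω` from `C`, as a set of functions. -/
def stateExtensions (C : StarSubalgebra ℂ A) (ω : A →L[ℂ] ℂ) : Set (A → ℂ) :=
  {f | ∃ φ : A →L[ℂ] ℂ, IsState φ ∧ (∀ c ∈ C, φ c = ω c) ∧ ⇑φ = f}

theorem stateExtensions_eq (C : StarSubalgebra ℂ A) {ω : A →L[ℂ] ℂ} (hω : IsState ω) :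
    stateExtensions C ω = {f | (∀ x y, f (x + y) = f x + f y) ∧ (∀ (z : ℂ) x, f (z • x) = z * f x) ∧
      (∀ x, f x ∈ Metric.closedBall 0 ‖x‖) ∧ (∀ x, f (star x * x) ∈ Set.Ici 0) ∧
      ∀ c ∈ C, f c = ω c} := by
  ext f
  constructor
  · rintro ⟨φ, hφ, hφω, rfl⟩
    refine ⟨fun x y => map_add φ x y, fun z x => by simp, fun x => ?_, hφ.2, hφω⟩
    simpa [hφ.1] using φ.le_opNorm x
  · rintro ⟨hadd, hsmul, hn, hp, hext⟩
    let l : A →ₗ[ℂ] ℂ := { toFun := f, map_add' := hadd, map_smul' := hsmul }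
    refine ⟨l.mkContinuous 1 fun x => by simpa [l] using hn x, ?_, hext, rfl⟩
    refine isState_of_nonneg_of_map_one hp ?_
    exact (hext 1 (one_mem C)).trans hω.map_one

theorem isCompact_stateExtensions (C : StarSubalgebra ℂ A) {ω : A →L[ℂ] ℂ} (hω : IsState ω) :
    IsCompact (stateExtensions C ω) := by
  have hK : IsCompact (Set.pi Set.univ fun x : A => Metric.closedBall (0 : ℂ) ‖x‖) :=
    isCompact_univ_pi fun x => isCompact_closedBall _ _
  rw [stateExtensions_eq C hω]
  refine hK.of_isClosed_subset ?_ fun f hf x _ => hf.2.2.1 x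
  simp only [Set.ofPred_and, Set.ofPred_forall]
  refine IsClosed.inter ?_ (IsClosed.inter ?_ (IsClosed.inter ?_ (IsClosed.inter ?_ ?_)))
  · exact isClosed_iInter fun x => isClosed_iInter fun y =>
      isClosed_eq (by fun_prop) (by fun_prop)
  · exact isClosed_iInter fun x => isClosed_iInter fun y =>
      isClosed_eq (by fun_prop) (by fun_prop)
  · exact isClosed_iInter fun x => Metric.isClosed_closedBall.preimage (continuous_apply x)
  · exact isClosed_iInter fun x => isClosed_Ici.preimage (continuous_apply (star x * x))
  · exact isClosed_iInter fun x => isClosed_iInter fun _ =>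
      isClosed_eq (by fun_prop) (by fun_prop)

theorem convex_stateExtensions (C : StarSubalgebra ℂ A) {ω : A →L[ℂ] ℂ} (hω : IsState ω) :
    Convex ℝ (stateExtensions C ω) := by
  rintro _ ⟨f, hf, hfω, rfl⟩ _ ⟨g, hg, hgω, rfl⟩ s t hs ht hst
  have hst' : (s : ℂ) + t = 1 := by exact_mod_cast hst
  have hext : ∀ c ∈ C, ((s : ℂ) • f + (t : ℂ) • g) c = ω c := fun c hc => by
    simp [hfω c hc, hgω c hc, ← add_mul, hst']
  refine ⟨(s : ℂ) • f + (t : ℂ) • g, isState_of_nonneg_of_map_one (fun a => ?_) ?_, hext, ?_⟩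
  · exact add_nonneg (mul_nonneg (by exact_mod_cast hs) (hf.2 a))
      (mul_nonneg (by exact_mod_cast ht) (hg.2 a))
  · exact (hext 1 (one_mem C)).trans hω.map_one
  · ext a
    simp

theorem isPureState_of_mem_extremePoints (C : StarSubalgebra ℂ A) {ω φ : A →L[ℂ] ℂ}
    (hω : IsState ω) (hm : ∀ a ∈ C, ∀ b ∈ C, ω (a * b) = ω a * ω b)
    (hφ : ⇑φ ∈ (stateExtensions C ω).extremePoints ℝ) : IsPureState φ := by
  obtain ⟨⟨φ', hφs, hφω, hφφ⟩, hφe⟩ := hφ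
  obtain rfl : φ' = φ := DFunLike.coe_injective hφφ
  have hmem : ∀ (f g : A →L[ℂ] ℂ) (t : ℝ), IsState f → IsState g → 0 < t → t < 1 →
      φ' = (t : ℂ) • f + ((1 : ℂ) - (t : ℂ)) • g → ∀ c ∈ C, f c = ω c := by
    intro f g t hf hg ht0 ht1 h c hc
    let i : C →ₗ[ℂ] A := C.subtype.toAlgHom.toLinearMap
    exact eq_of_multiplicative_of_convex ((f : A →ₗ[ℂ] ℂ) ∘ₗ i) ((g : A →ₗ[ℂ] ℂ) ∘ₗ i)
      ((ω : A →ₗ[ℂ] ℂ) ∘ₗ i) (fun a => hf.2 a) (fun a => hg.2 a)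
      (fun a b => hm a a.2 b b.2) hω.map_one hf.map_one t ht0 ht1
      (fun a => (hφω a a.2).symm.trans (by simp [h, i])) ⟨c, hc⟩
  refine ⟨hφs, fun f g t hf hg ht0 ht1 h => ?_⟩
  have h' : φ' = ((1 - t : ℝ) : ℂ) • g + ((1 : ℂ) - ((1 - t : ℝ) : ℂ)) • f := by
    rw [h]; push_cast; module
  have hfS : ⇑f ∈ stateExtensions C ω := ⟨f, hf, hmem f g t hf hg ht0 ht1 h, rfl⟩
  have hgS : ⇑g ∈ stateExtensions C ω :=
    ⟨g, hg, hmem g f (1 - t) hg hf (by linarith) (by linarith) h', rfl⟩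
  have hseg : ⇑φ' ∈ openSegment ℝ ⇑f ⇑g :=
    ⟨t, 1 - t, ht0, by linarith, by ring, by ext a; simp [h]⟩
  have hseg' : ⇑φ' ∈ openSegment ℝ ⇑g ⇑f := openSegment_symm ℝ (⇑f) (⇑g) ▸ hseg
  exact ⟨DFunLike.coe_injective (hφe hfS hgS hseg), DFunLike.coe_injective (hφe hgS hfS hseg')⟩

/-- If a state is multiplicative on `C` and its restriction to `C` has at most one pure extension,
then it is itself that extension. -/
theorem IsState.eq_of_unique_pure_extension (C : StarSubalgebra ℂ A) {ω ψ : A →L[ℂ] ℂ}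
    (hω : IsState ω) (hm : ∀ a ∈ C, ∀ b ∈ C, ω (a * b) = ω a * ω b)
    (hu : ∀ φ : A →L[ℂ] ℂ, IsPureState φ → (∀ c ∈ C, φ c = ω c) → φ = ψ) :
    ω = ψ ∧ IsPureState ω := by
  have hωS : ⇑ω ∈ stateExtensions C ω := ⟨ω, hω, fun _ _ => rfl, rfl⟩
  have hsub : (stateExtensions C ω).extremePoints ℝ ⊆ {⇑ψ} := by
    intro f hf
    obtain ⟨φ, -, hφω, rfl⟩ := hf.1
    rw [hu φ (isPureState_of_mem_extremePoints C hω hm hf) hφω]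
    rfl
  have hKM := closure_convexHull_extremePoints (isCompact_stateExtensions C hω)
    (convex_stateExtensions C hω)
  have hωψ : ⇑ω ∈ closure (convexHull ℝ {⇑ψ}) :=
    closure_mono (convexHull_mono hsub) (hKM.symm ▸ hωS)
  rw [convexHull_singleton, closure_singleton] at hωψ
  have hωψ : ω = ψ := DFunLike.coe_injective hωψ
  refine ⟨hωψ, isPureState_of_mem_extremePoints C hω hm ?_⟩
  obtain ⟨f, hf⟩ := (isCompact_stateExtensions C hω).extremePoints_nonempty ⟨_, hωS⟩
  have := hsub hf
  rw [← hωψ] at this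
  exact this ▸ hf

theorem IsState.eq_of_extensionProperty (C : StarSubalgebra ℂ A) (hC : HasExtensionPropertyU C)
    {ω ω' : A →L[ℂ] ℂ} (hω : IsState ω) (hω' : IsState ω')
    (hm : ∀ a ∈ C, ∀ b ∈ C, ω (a * b) = ω a * ω b) (h : ∀ c ∈ C, ω c = ω' c) :
    ω = ω' ∧ IsPureState ω := by
  let χ : C →L[ℂ] ℂ := ω.comp (C.toSubalgebra.toSubmodule.subtypeL)
  have hχs : IsState χ := isState_of_nonneg_of_map_one (fun a => hω.2 a) hω.map_one
  have hχ : IsPureState χ := hχs.isPureState_of_multiplicative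
      fun a b => hm a a.2 b b.2
  obtain ⟨ψ, -, hu⟩ := hC χ hχ
  have h1 := hω.eq_of_unique_pure_extension C (ψ := ψ) hm
    fun φ hφ hφω => hu φ ⟨hφ, fun c => hφω c c.2⟩
  have h2 := hω'.eq_of_unique_pure_extension C (ψ := ψ)
    (fun a ha b hb => by rw [← h _ ha, ← h _ hb, ← h _ (mul_mem ha hb), hm a ha b hb])
    fun φ hφ hφω => hu φ ⟨hφ, fun c => (hφω c c.2).trans (h c c.2).symm⟩
  exact ⟨h1.1.trans h2.1.symm, h1.2⟩

end UniqueExtension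

namespace CStarCompletion

variable {A₁ A₂ T : Type*} [CStarAlgebra A₁] [CStarAlgebra A₂] [CStarAlgebra T]
  (K : CStarCompletion A₁ A₂ T)

theorem ext_of_tensor {F G : T →L[ℂ] ℂ} (h : ∀ a b, F (K.ι₁ a * K.ι₂ b) = G (K.ι₁ a * K.ι₂ b)) :
    F = G := by
  refine ContinuousLinearMap.ext_on K.dense_span ?_
  rintro _ ⟨a, b, rfl⟩
  exact h a b

theorem ι₁_one_mul_ι₂_one : K.ι₁ 1 * K.ι₂ 1 = 1 := by
  have h : ContinuousLinearMap.mul ℂ T (K.ι₁ 1 * K.ι₂ 1) = ContinuousLinearMap.id ℂ T := by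
    refine ContinuousLinearMap.ext_on K.dense_span ?_
    rintro _ ⟨a, b, rfl⟩
    calc K.ι₁ 1 * K.ι₂ 1 * (K.ι₁ a * K.ι₂ b) = K.ι₁ 1 * (K.ι₂ 1 * K.ι₁ a) * K.ι₂ b := by
          simp only [mul_assoc]
      _ = K.ι₁ (1 * a) * K.ι₂ (1 * b) := by
          rw [← K.commutes, map_mul, map_mul]; simp only [mul_assoc]
      _ = K.ι₁ a * K.ι₂ b := by simp only [one_mul]
  simpa using congrArg (fun F => F 1) h

theorem ι₁_one : K.ι₁ 1 = 1 := by
  calc K.ι₁ 1 = K.ι₁ 1 * (K.ι₁ 1 * K.ι₂ 1) := by rw [ι₁_one_mul_ι₂_one, mul_one]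
    _ = 1 := by rw [← mul_assoc, ← map_mul, one_mul, ι₁_one_mul_ι₂_one]

theorem ι₂_one : K.ι₂ 1 = 1 := by
  rw [← K.ι₁_one_mul_ι₂_one, ι₁_one, one_mul]

/-- The first embedding as a continuous linear map. -/
def ι₁L : A₁ →L[ℂ] T :=
  ⟨{ toFun := K.ι₁, map_add' := map_add K.ι₁, map_smul' := map_smul K.ι₁ }, K.isometry₁.continuous⟩

/-- The second embedding as a continuous linear map. -/
def ι₂L : A₂ →L[ℂ] T :=
  ⟨{ toFun := K.ι₂, map_add' := map_add K.ι₂, map_smul' := map_smul K.ι₂ }, K.isometry₂.continuous⟩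

@[simp] theorem ι₁L_apply (a : A₁) : K.ι₁L a = K.ι₁ a := rfl

@[simp] theorem ι₂L_apply (b : A₂) : K.ι₂L b = K.ι₂ b := rfl

theorem isState_comp_ι₁L {φ : T →L[ℂ] ℂ} (hφ : IsState φ) : IsState (φ.comp K.ι₁L) := by
  refine isState_of_nonneg_of_map_one (fun a => ?_) ?_
  · simpa [map_mul, map_star] using hφ.2 (K.ι₁ a)
  · simp [K.ι₁_one, hφ.map_one]

theorem isState_comp_ι₂L {φ : T →L[ℂ] ℂ} (hφ : IsState φ) : IsState (φ.comp K.ι₂L) := by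
  refine isState_of_nonneg_of_map_one (fun a => ?_) ?_
  · simpa [map_mul, map_star] using hφ.2 (K.ι₂ a)
  · simp [K.ι₂_one, hφ.map_one]

theorem nonneg_apply_tensor {φ : T →L[ℂ] ℂ} (hφ : IsState φ) (a : A₁) (c : A₂) :
    0 ≤ φ (K.ι₁ (star a * a) * K.ι₂ (star c * c)) := by
  convert hφ.2 (K.ι₁ a * K.ι₂ c) using 2
  rw [star_mul, map_mul, map_mul, ← map_star, ← map_star]
  calc K.ι₁ (star a) * K.ι₁ a * (K.ι₂ (star c) * K.ι₂ c)
      = K.ι₁ (star a) * (K.ι₁ a * K.ι₂ (star c)) * K.ι₂ c := by simp only [mul_assoc]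
    _ = K.ι₁ (star a) * K.ι₂ (star c) * K.ι₁ a * K.ι₂ c := by
        rw [K.commutes]; simp only [mul_assoc]
    _ = K.ι₂ (star c) * K.ι₁ (star a) * (K.ι₁ a * K.ι₂ c) := by
        rw [K.commutes]; simp only [mul_assoc]

/-- A state on the tensor product whose first marginal is pure is a product state. -/
theorem apply_tensor_of_isPureState {φ : T →L[ℂ] ℂ} (hφ : IsState φ)
    (hp : IsPureState (φ.comp K.ι₁L)) (a : A₁) (b : A₂) :
    φ (K.ι₁ a * K.ι₂ b) = φ (K.ι₁ a) * φ (K.ι₂ b) := by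
  have hsmall : ∀ b : A₂, IsSelfAdjoint b → ‖b‖ ≤ 1 / 4 →
      φ (K.ι₁ a * K.ι₂ b) = φ (K.ι₁ a) * φ (K.ι₂ b) := by
    intro b hb hn
    obtain ⟨c, hc⟩ := exists_star_mul_self_eq_half_add hb (by linarith)
    obtain ⟨d, hd⟩ := exists_star_mul_self_eq_half_add hb.neg (by rw [norm_neg]; linarith)
    have hreal : φ (K.ι₂ b) = ((φ (K.ι₂ b)).re : ℂ) := by
      have h1 := (Complex.le_def.1 ((K.isState_comp_ι₂L hφ).2 c)).2
      rw [← hc] at h1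
      simp [K.ι₂_one, hφ.map_one, ← Complex.coe_smul] at h1
      exact Complex.ext (by simp) (by simpa using h1.symm)
    have hle : ‖φ (K.ι₂ b)‖ ≤ 1 / 4 := by
      have := (K.isState_comp_ι₂L hφ).1 ▸ (φ.comp K.ι₂L).le_opNorm b
      simp at this
      linarith
    set s := (φ (K.ι₂ b)).re with hs
    have hs' : |s| ≤ 1 / 4 := (Complex.abs_re_le_norm _).trans hle
    obtain ⟨hs1, hs2⟩ := abs_le.1 hs'
    let g : A₁ →L[ℂ] ℂ :=
      (φ.comp ((ContinuousLinearMap.mul ℂ T).flip (K.ι₂ ((1 / 2 : ℝ) • 1 + b)))).comp K.ι₁L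
    let k : A₁ →L[ℂ] ℂ :=
      (φ.comp ((ContinuousLinearMap.mul ℂ T).flip (K.ι₂ ((1 / 2 : ℝ) • 1 + -b)))).comp K.ι₁L
    have hg : ∀ a, g a = (1 / 2 : ℂ) * φ (K.ι₁ a) + φ (K.ι₁ a * K.ι₂ b) := fun a => by
      simp [g, ← Complex.coe_smul, K.ι₂_one]
    have hk : ∀ a, k a = (1 / 2 : ℂ) * φ (K.ι₁ a) - φ (K.ι₁ a * K.ι₂ b) := fun a => by
      simp [k, ← Complex.coe_smul, K.ι₂_one, sub_eq_add_neg]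
    have hgp : ∀ a, 0 ≤ g (star a * a) := fun a => by
      have := K.nonneg_apply_tensor hφ a c
      rwa [← hc] at this
    have hkp : ∀ a, 0 ≤ k (star a * a) := fun a => by
      have := K.nonneg_apply_tensor hφ a d
      rwa [← hd] at this
    have hg1 : g 1 = ((1 / 2 + s : ℝ) : ℂ) := by
      rw [hg, K.ι₁_one, hφ.map_one, one_mul, hreal]; push_cast; ring
    have hk1 : k 1 = ((1 / 2 - s : ℝ) : ℂ) := by
      rw [hk, K.ι₁_one, hφ.map_one, one_mul, hreal]; push_cast; ring
    have hpos : 0 < 1 / 2 + s := by linarith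
    have hpos' : 0 < 1 / 2 - s := by linarith
    have hne : ((1 / 2 + s : ℝ) : ℂ) ≠ 0 := by exact_mod_cast hpos.ne'
    have hne' : ((1 / 2 - s : ℝ) : ℂ) ≠ 0 := by exact_mod_cast hpos'.ne'
    have h1 : IsState (((1 / 2 + s : ℝ) : ℂ)⁻¹ • g) := by
      refine isState_of_nonneg_of_map_one (fun a => ?_) ?_
      · refine mul_nonneg ?_ (hgp a)
        rw [← Complex.ofReal_inv]
        exact_mod_cast (inv_pos.2 hpos).le
      · change _ * g 1 = 1
        rw [hg1, inv_mul_cancel₀ hne]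
    have h2 : IsState (((1 / 2 - s : ℝ) : ℂ)⁻¹ • k) := by
      refine isState_of_nonneg_of_map_one (fun a => ?_) ?_
      · refine mul_nonneg ?_ (hkp a)
        rw [← Complex.ofReal_inv]
        exact_mod_cast (inv_pos.2 hpos').le
      · change _ * k 1 = 1
        rw [hk1, inv_mul_cancel₀ hne']
    have h3 := (hp.2 _ _ (1 / 2 + s) h1 h2 hpos (by linarith) (by
      rw [smul_inv_smul₀ hne, show (1 : ℂ) - ((1 / 2 + s : ℝ) : ℂ) = ((1 / 2 - s : ℝ) : ℂ) by
        push_cast; ring, smul_inv_smul₀ hne']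
      ext a
      change φ (K.ι₁ a) = g a + k a
      rw [hg, hk]; ring)).1
    have h4 : ((1 / 2 + s : ℝ) : ℂ)⁻¹ * g a = φ (K.ι₁ a) := congrArg (fun F => F a) h3
    rw [inv_mul_eq_iff_eq_mul₀ hne, hg] at h4
    rw [hreal]
    push_cast at h4
    linear_combination h4
  have hsa : ∀ b : A₂, IsSelfAdjoint b →
      φ (K.ι₁ a * K.ι₂ b) = φ (K.ι₁ a) * φ (K.ι₂ b) := by
    intro b hb
    have hr : (0 : ℝ) < 4 * (‖b‖ + 1) := by positivity
    have h := hsmall ((4 * (‖b‖ + 1))⁻¹ • b) ((IsSelfAdjoint.all _).smul hb) (by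
      rw [norm_smul, norm_inv, Real.norm_of_nonneg hr.le, inv_mul_le_iff₀ hr]
      linarith)
    rw [← Complex.coe_smul, map_smul, mul_smul_comm, map_smul, map_smul, smul_eq_mul, smul_eq_mul,
      mul_left_comm] at h
    exact mul_left_cancel₀ (by exact_mod_cast (inv_pos.2 hr).ne') h
  rw [← realPart_add_I_smul_imaginaryPart b, map_add, mul_add, map_add, map_add, map_smul,
    mul_smul_comm, map_smul, map_smul, hsa _ (realPart b).2, hsa _ (imaginaryPart b).2,
    smul_eq_mul, smul_eq_mul]
  ring

end CStarCompletion

section Characters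

variable {A : Type*} [CStarAlgebra A]

/-- A character of a closed subalgebra extends to a state. -/
theorem exists_state_extending_character (D : StarSubalgebra ℂ A) (hD : IsClosed (D : Set A))
    (χ : WeakDual.characterSpace ℂ D) :
    ∃ φ : A →L[ℂ] ℂ, IsState φ ∧ ∀ d : D, φ d = (χ : WeakDual ℂ D) d := by
  have hcs : CompleteSpace D := hD.completeSpace_coe
  let f : StrongDual ℂ D.toSubalgebra.toSubmodule := WeakDual.toStrongDual (χ : WeakDual ℂ D)
  have h1 : ‖(1 : D)‖ ≤ 1 := by
    change ‖(1 : A)‖ ≤ 1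
    rcases subsingleton_or_nontrivial A with hA | hA
    · simp [Subsingleton.elim (1 : A) 0]
    · simp
  have hle : ∀ x : D, ‖χ x‖ ≤ 1 * ‖x‖ := fun x => by
    have h := spectrum.norm_le_norm_mul_of_mem (AlgHom.apply_mem_spectrum
      (WeakDual.CharacterSpace.toAlgHom χ) x)
    rw [mul_comm] at h
    exact h.trans (mul_le_mul_of_nonneg_right h1 (norm_nonneg x))
  have hf : ‖f‖ ≤ 1 := f.opNorm_le_bound zero_le_one hle
  obtain ⟨φ, hφ, hn⟩ := exists_extension_norm_eq D.toSubalgebra.toSubmodule f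
  refine ⟨φ, isState_of_norm_le_one (hn.trans_le hf) ?_, hφ⟩
  exact (hφ (1 : D)).trans (map_one χ)

/-- A subalgebra of a commutative C⋆-algebra separating the characters is dense. -/
theorem StarSubalgebra.dense_of_separates_characters {A : Type*} [CommCStarAlgebra A]
    (B : StarSubalgebra ℂ A)
    (h : ∀ χ χ' : WeakDual.characterSpace ℂ A, (∀ b ∈ B, χ b = χ' b) → χ = χ') :
    Dense (B : Set A) := by
  let G : A →⋆ₐ[ℂ] C(WeakDual.characterSpace ℂ A, ℂ) := gelfandStarTransform A
  have hG : Isometry G := gelfandTransform_isometry A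
  have hsep : (B.map G).SeparatesPoints := by
    intro χ χ' hne
    by_contra hc
    push Not at hc
    refine hne (h χ χ' fun b hb => ?_)
    exact hc (G b) ⟨G b, ⟨b, hb, rfl⟩, rfl⟩
  have htop := ContinuousMap.starSubalgebra_topologicalClosure_eq_top_of_separatesPoints _ hsep
  intro a
  have ha : G a ∈ closure (G '' (B : Set A)) := by
    have h1 : G a ∈ ((B.map G).topologicalClosure : Set _) := by rw [htop]; trivial
    rwa [StarSubalgebra.topologicalClosure_coe] at h1
  rwa [hG.isUniformInducing.isInducing.closure_eq_preimage_closure_image]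

end Characters

namespace CStarCompletion

variable {A₁ A₂ T : Type*} [CStarAlgebra A₁] [CStarAlgebra A₂] [CStarAlgebra T]
  (K : CStarCompletion A₁ A₂ T)

/-- The linear span of the elementary tensors `c₁ ⊗ c₂` with `cᵢ ∈ Cᵢ`. -/
def tensorSpan (C₁ : StarSubalgebra ℂ A₁) (C₂ : StarSubalgebra ℂ A₂) : StarSubalgebra ℂ T where
  toSubalgebra := (Submodule.span ℂ {x : T | ∃ a ∈ (C₁ : Set A₁), ∃ b ∈ (C₂ : Set A₂),
      x = K.ι₁ a * K.ι₂ b}).toSubalgebra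
    (Submodule.subset_span ⟨1, one_mem C₁, 1, one_mem C₂, K.ι₁_one_mul_ι₂_one.symm⟩) <| by
      intro x y hx hy
      have h := Submodule.mul_mem_mul hx hy
      rw [Submodule.span_mul_span] at h
      refine Submodule.span_mono ?_ h
      rintro _ ⟨_, ⟨a, ha, b, hb, rfl⟩, _, ⟨a', ha', b', hb', rfl⟩, rfl⟩
      refine ⟨a * a', mul_mem ha ha', b * b', mul_mem hb hb', ?_⟩
      calc K.ι₁ a * K.ι₂ b * (K.ι₁ a' * K.ι₂ b') = K.ι₁ a * (K.ι₂ b * K.ι₁ a') * K.ι₂ b' := by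
            simp only [mul_assoc]
        _ = K.ι₁ (a * a') * K.ι₂ (b * b') := by
            rw [← K.commutes, map_mul, map_mul]; simp only [mul_assoc]
  star_mem' := by
    intro x hx
    change x ∈ Submodule.span ℂ _ at hx
    change star x ∈ Submodule.span ℂ _
    induction hx using Submodule.span_induction with
    | mem x hx =>
      obtain ⟨a, ha, b, hb, rfl⟩ := hx
      refine Submodule.subset_span ⟨star a, star_mem ha, star b, star_mem hb, ?_⟩
      rw [star_mul, ← map_star, ← map_star, K.commutes]
    | zero => simp
    | add x y _ _ hx hy => rw [star_add]; exact add_mem hx hy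
    | smul z x _ hx => rw [star_smul]; exact Submodule.smul_mem _ _ hx

end CStarCompletion

/-- Note 2: if both masas have the extension property, any character of
an abelian C*-subalgebra `D` containing `C₁ ⊗ C₂` extending `χ₁ ⊗ χ₂` is the
restriction of `ψ₁ ⊗ ψ₂`, and consequently `D = C₁ ⊗ C₂`. -/
theorem stmt_7 {A₁ A₂ T : Type*} [CStarAlgebra A₁] [CStarAlgebra A₂] [CStarAlgebra T]
    (K : CStarCompletion A₁ A₂ T)
    (C₁ : StarSubalgebra ℂ A₁) (C₂ : StarSubalgebra ℂ A₂)
    (h₁ : IsMasaU C₁) (h₂ : IsMasaU C₂)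
    (he₁ : HasExtensionPropertyU C₁) (he₂ : HasExtensionPropertyU C₂)
    (χ₁ : WeakDual.characterSpace ℂ ↥C₁) (χ₂ : WeakDual.characterSpace ℂ ↥C₂)
    (ψ₁ : A₁ →L[ℂ] ℂ) (ψ₂ : A₂ →L[ℂ] ℂ)
    (hψ₁ : IsPureState ψ₁) (hψ₂ : IsPureState ψ₂)
    (hψ₁e : ∀ c : ↥C₁, ψ₁ ↑c = (χ₁ : WeakDual ℂ ↥C₁) c)
    (hψ₂e : ∀ c : ↥C₂, ψ₂ ↑c = (χ₂ : WeakDual ℂ ↥C₂) c)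
    (hu₁ : ∀ φ : A₁ →L[ℂ] ℂ, IsPureState φ →
      (∀ c : ↥C₁, φ ↑c = (χ₁ : WeakDual ℂ ↥C₁) c) → φ = ψ₁)
    (hu₂ : ∀ φ : A₂ →L[ℂ] ℂ, IsPureState φ →
      (∀ c : ↥C₂, φ ↑c = (χ₂ : WeakDual ℂ ↥C₂) c) → φ = ψ₂)
    (ψ : T →L[ℂ] ℂ) (hψ : IsState ψ)
    (hfact : ∀ (a : A₁) (b : A₂), ψ (K.ι₁ a * K.ι₂ b) = ψ₁ a * ψ₂ b)
    (D : StarSubalgebra ℂ T) (hDc : IsClosed (D : Set T))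
    (hDab : ∀ x ∈ D, ∀ y ∈ D, x * y = y * x)
    (hDsub : ∀ c₁ ∈ C₁, ∀ c₂ ∈ C₂, K.ι₁ c₁ * K.ι₂ c₂ ∈ D) :
    (∀ χ : WeakDual.characterSpace ℂ ↥D,
        (∀ (c₁ : ↥C₁) (c₂ : ↥C₂),
          (χ : WeakDual ℂ ↥D) ⟨K.ι₁ ↑c₁ * K.ι₂ ↑c₂, hDsub ↑c₁ c₁.2 ↑c₂ c₂.2⟩ =
            (χ₁ : WeakDual ℂ ↥C₁) c₁ * (χ₂ : WeakDual ℂ ↥C₂) c₂) →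
        ∀ d : ↥D, (χ : WeakDual ℂ ↥D) d = ψ ↑d) ∧
    (D : Set T) = tensorSet K (C₁ : Set A₁) (C₂ : Set A₂) := by
  have hι₁ : ∀ a, K.ι₁ a = K.ι₁ a * K.ι₂ 1 := fun a => by rw [K.ι₂_one, mul_one]
  have hι₂ : ∀ b, K.ι₂ b = K.ι₁ 1 * K.ι₂ b := fun b => by rw [K.ι₁_one, one_mul]
  have hD₁ : ∀ c ∈ C₁, K.ι₁ c ∈ D := fun c hc => hι₁ c ▸ hDsub c hc 1 (one_mem C₂)
  have hD₂ : ∀ c ∈ C₂, K.ι₂ c ∈ D := fun c hc => hι₂ c ▸ hDsub 1 (one_mem C₁) c hc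
  refine ⟨fun χ hχ => ?_, Set.Subset.antisymm ?_ ?_⟩
  · obtain ⟨φ, hφ, hφχ⟩ := exists_state_extending_character D hDc χ
    have hval : ∀ (c₁ : C₁) (c₂ : C₂), φ (K.ι₁ c₁ * K.ι₂ c₂) = χ₁ c₁ * χ₂ c₂ :=
      fun c₁ c₂ => (hφχ ⟨_, hDsub c₁ c₁.2 c₂ c₂.2⟩).trans (hχ c₁ c₂)
    have hval₁ : ∀ c : C₁, φ.comp K.ι₁L c = χ₁ c := fun c => by
      have := hval c 1
      rw [map_one, mul_one] at this
      rw [← this]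
      exact congrArg φ (hι₁ c)
    have hval₂ : ∀ c : C₂, φ.comp K.ι₂L c = χ₂ c := fun c => by
      have := hval 1 c
      rw [map_one, one_mul] at this
      rw [← this]
      exact congrArg φ (hι₂ c)
    have hm₁ : ∀ a ∈ C₁, ∀ b ∈ C₁,
        φ.comp K.ι₁L (a * b) = φ.comp K.ι₁L a * φ.comp K.ι₁L b := fun a ha b hb =>
      (hval₁ (⟨a, ha⟩ * ⟨b, hb⟩)).trans <| (map_mul χ₁ _ _).trans <|
        congrArg₂ _ (hval₁ ⟨a, ha⟩).symm (hval₁ ⟨b, hb⟩).symm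
    have hm₂ : ∀ a ∈ C₂, ∀ b ∈ C₂,
        φ.comp K.ι₂L (a * b) = φ.comp K.ι₂L a * φ.comp K.ι₂L b := fun a ha b hb =>
      (hval₂ (⟨a, ha⟩ * ⟨b, hb⟩)).trans <| (map_mul χ₂ _ _).trans <|
        congrArg₂ _ (hval₂ ⟨a, ha⟩).symm (hval₂ ⟨b, hb⟩).symm
    obtain ⟨e₁, hp⟩ := (K.isState_comp_ι₁L hφ).eq_of_unique_pure_extension C₁ hm₁
      fun ρ hρ h => hu₁ ρ hρ fun c => (h c c.2).trans (hval₁ c)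
    obtain ⟨e₂, -⟩ := (K.isState_comp_ι₂L hφ).eq_of_unique_pure_extension C₂ hm₂
      fun ρ hρ h => hu₂ ρ hρ fun c => (h c c.2).trans (hval₂ c)
    have hφψ : φ = ψ := K.ext_of_tensor fun a b => by
      rw [hfact, K.apply_tensor_of_isPureState hφ hp, ← e₁, ← e₂]
      rfl
    exact fun d => hφψ ▸ (hφχ d).symm
  · let B := K.tensorSpan C₁ C₂
    let _ : CommCStarAlgebra D :=
      { StarSubalgebra.cstarAlgebra D (h_closed := hDc) with
        mul_comm := fun x y => Subtype.ext (hDab x x.2 y y.2) }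
    have hdense : Dense ((B.comap D.subtype : StarSubalgebra ℂ D) : Set D) := by
      refine StarSubalgebra.dense_of_separates_characters _ fun χ χ' h => ?_
      obtain ⟨φ, hφ, hφχ⟩ := exists_state_extending_character D hDc χ
      obtain ⟨φ', hφ', hφχ'⟩ := exists_state_extending_character D hDc χ'
      have hm : ∀ a ∈ D, ∀ b ∈ D, φ (a * b) = φ a * φ b := fun a ha b hb =>
        (hφχ (⟨a, ha⟩ * ⟨b, hb⟩)).trans <| (map_mul χ _ _).trans <|
          congrArg₂ _ (hφχ ⟨a, ha⟩).symm (hφχ ⟨b, hb⟩).symm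
      have hag : ∀ x ∈ D, x ∈ B → φ x = φ' x := fun x hx hxB =>
        (hφχ ⟨x, hx⟩).trans <| (h ⟨x, hx⟩ hxB).trans (hφχ' ⟨x, hx⟩).symm
      obtain ⟨e₁, hp⟩ := (K.isState_comp_ι₁L hφ).eq_of_extensionProperty C₁ he₁
        (K.isState_comp_ι₁L hφ')
        (fun a ha b hb => by
          simpa using hm _ (hD₁ a ha) _ (hD₁ b hb))
        (fun c hc => hag _ (hD₁ c hc) <| Submodule.subset_span ⟨c, hc, 1, one_mem C₂, hι₁ c⟩)
      obtain ⟨e₂, -⟩ := (K.isState_comp_ι₂L hφ).eq_of_extensionProperty C₂ he₂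
        (K.isState_comp_ι₂L hφ')
        (fun a ha b hb => by
          simpa using hm _ (hD₂ a ha) _ (hD₂ b hb))
        (fun c hc => hag _ (hD₂ c hc) <| Submodule.subset_span ⟨1, one_mem C₁, c, hc, hι₂ c⟩)
      have hφφ' : φ = φ' := K.ext_of_tensor fun a b => by
        rw [K.apply_tensor_of_isPureState hφ hp, K.apply_tensor_of_isPureState hφ' (e₁ ▸ hp)]
        exact congrArg₂ _ (congrArg (fun F => F a) e₁) (congrArg (fun F => F b) e₂)
      exact WeakDual.CharacterSpace.ext fun d =>
        (hφχ d).symm.trans <| (congrArg (fun F => F (d : T)) hφφ').trans (hφχ' d)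
    intro d hd
    exact closure_mono (Set.image_subset_iff.2 fun x hx => hx)
      (image_closure_subset_closure_image continuous_subtype_val ⟨⟨d, hd⟩, hdense _, rfl⟩)
  · refine closure_minimal (fun x hx => ?_) hDc
    refine (Submodule.span_le (p := D.toSubalgebra.toSubmodule)).2 ?_ hx
    rintro _ ⟨a, ha, b, hb, rfl⟩
    exact hDsub a ha b hb
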